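/- arXiv:1410.1698 — 2 statements merged into one kernel-verified Lean document; each statement's English description precedes it below -/
import Mathlib

section
/- Let Δ ⊂ ℝ² be a two-dimensional lattice polygon such that Δ^{(1)} is two-dimensional, and let d ≥ 2 be an integer. Then the Minkowski sum ((d−1)Δ^{(1)})^{(1)} + Δ = {u + v : u ∈ ((d−1)Δ^{(1)})^{(1)}, v ∈ Δ} is contained in dΔ^{(1)}. -/
open Pointwise

noncomputable section

def toR (p : ℤ × ℤ) : ℝ × ℝ := ((p.1 : ℝ), (p.2 : ℝ))

def IsLatticePolygon (P : Set (ℝ × ℝ)) : Prop :=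
  ∃ S : Finset (ℤ × ℤ), P = convexHull ℝ (toR '' ↑S)

def latticePts (A : Set (ℝ × ℝ)) : Set (ℤ × ℤ) := {p | toR p ∈ A}

def interiorHull (P : Set (ℝ × ℝ)) : Set (ℝ × ℝ) :=
  convexHull ℝ (toR '' latticePts (interior P))

/-- The signed area of the parallelogram spanned by two plane vectors. -/
def cross (u v : ℝ × ℝ) : ℝ := u.1 * v.2 - u.2 * v.1

theorem sq_add_sq_pos {u : ℝ × ℝ} (hu : u ≠ 0) : 0 < u.1 ^ 2 + u.2 ^ 2 := by
  by_contra! h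
  apply hu
  ext
  · rw [Prod.fst_zero]
    nlinarith [sq_nonneg u.1, sq_nonneg u.2]
  · rw [Prod.snd_zero]
    nlinarith [sq_nonneg u.1, sq_nonneg u.2]

theorem collinear_of_cross_eq_zero {F : Set (ℝ × ℝ)} {p u : ℝ × ℝ} (hu : u ≠ 0)
    (h : ∀ r ∈ F, cross u (r - p) = 0) : Collinear ℝ F := by
  rw [collinear_iff_exists_forall_eq_smul_vadd]
  have hn := (sq_add_sq_pos hu).ne'
  refine ⟨p, u, fun r hr => ⟨(u.1 * (r.1 - p.1) + u.2 * (r.2 - p.2)) / (u.1 ^ 2 + u.2 ^ 2), ?_⟩⟩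
  have h1 := h r hr
  simp only [cross, Prod.fst_sub, Prod.snd_sub] at h1
  ext
  · simp only [vadd_eq_add, Prod.fst_add, Prod.smul_fst, smul_eq_mul]
    field_simp
    linear_combination (-u.2) * h1
  · simp only [vadd_eq_add, Prod.snd_add, Prod.smul_snd, smul_eq_mul]
    field_simp
    linear_combination u.1 * h1

/-- A point outside a two-dimensional polygon is strictly separated from it by one of its edges. -/
theorem exists_edge_separating {F : Set (ℝ × ℝ)} (hfin : F.Finite) (hF : ¬ Collinear ℝ F)
    {z : ℝ × ℝ} (hz : z ∉ convexHull ℝ F) :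
    ∃ p ∈ F, ∃ q ∈ F, p ≠ q ∧ (∀ r ∈ F, 0 ≤ cross (q - p) (r - p)) ∧
      cross (q - p) (z - p) < 0 := by
  obtain ⟨f, c, hfc, hcz⟩ := geometric_hahn_banach_closed_point (convex_convexHull ℝ F)
    (hfin.isClosed_convexHull ℝ) hz
  have hfz : ∀ r ∈ F, f r < f z := fun r hr => (hfc r (subset_convexHull ℝ F hr)).trans hcz
  obtain ⟨a, b, hab⟩ : ∃ a b : ℝ, ∀ x : ℝ × ℝ, f x = a * x.1 + b * x.2 := by
    refine ⟨f (1, 0), f (0, 1), fun x => ?_⟩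
    have hx : x = x.1 • ((1 : ℝ), (0 : ℝ)) + x.2 • ((0 : ℝ), (1 : ℝ)) := by ext <;> simp
    conv_lhs => rw [hx]
    rw [map_add, map_smul, map_smul, smul_eq_mul, smul_eq_mul]
    ring
  have hne : F.Nonempty := by
    rw [Set.nonempty_iff_ne_empty]
    rintro rfl
    exact hF (collinear_empty ℝ _)
  obtain ⟨p, hp, hmax⟩ := Set.exists_max_image F f hfin hne
  have hzp : 0 < a * (z.1 - p.1) + b * (z.2 - p.2) := by
    have := hfz p hp
    rw [hab, hab] at this
    linarith
  have hpos : 0 < a ^ 2 + b ^ 2 := by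
    by_contra! h
    have ha : a = 0 := by nlinarith [sq_nonneg a, sq_nonneg b]
    have hb : b = 0 := by nlinarith [sq_nonneg a, sq_nonneg b]
    simp [ha, hb] at hzp
  have hle : ∀ r ∈ F, a * (r.1 - p.1) + b * (r.2 - p.2) ≤ 0 := by
    intro r hr
    have := hmax r hr
    rw [hab, hab] at this
    linarith
  by_cases htie : ∃ q ∈ F, q ≠ p ∧ f q = f p
  · obtain ⟨q, hq, hqp, hfq⟩ := htie
    have he : a * (q.1 - p.1) + b * (q.2 - p.2) = 0 := by
      rw [hab, hab] at hfq
      linarith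
    set k : ℝ := a * (q.2 - p.2) - b * (q.1 - p.1) with hk
    have hcr : ∀ x : ℝ × ℝ, (a ^ 2 + b ^ 2) * cross (q - p) (x - p) =
        - k * (a * (x.1 - p.1) + b * (x.2 - p.2)) := by
      intro x
      simp only [cross, Prod.fst_sub, Prod.snd_sub, hk]
      linear_combination (a * (x.2 - p.2) - b * (x.1 - p.1)) * he
    have hsw : ∀ x : ℝ × ℝ, cross (p - q) (x - q) = - cross (q - p) (x - p) := by
      intro x
      simp only [cross, Prod.fst_sub, Prod.snd_sub]
      ring
    have hk0 : k ≠ 0 := by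
      intro hk0
      apply hF
      refine collinear_of_cross_eq_zero (p := p) (u := q - p) (sub_ne_zero.2 hqp) fun r _ => ?_
      have := hcr r
      rw [hk0] at this
      simpa [hpos.ne'] using this
    rcases lt_or_gt_of_ne hk0 with hk1 | hk1
    · refine ⟨q, hq, p, hp, hqp, fun r hr => ?_, ?_⟩
      · rw [hsw]
        have := hcr r
        have := mul_nonneg_of_nonpos_of_nonpos hk1.le (hle r hr)
        by_contra! h
        nlinarith
      · rw [hsw]
        have := hcr z
        have := mul_neg_of_neg_of_pos hk1 hzp
        by_contra! h
        nlinarith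
    · refine ⟨p, hp, q, hq, hqp.symm, fun r hr => ?_, ?_⟩
      · have := hcr r
        have := mul_nonpos_of_nonneg_of_nonpos hk1.le (hle r hr)
        by_contra! h
        nlinarith
      · have := hcr z
        have := mul_pos hk1 hzp
        by_contra! h
        nlinarith
  · push Not at htie
    have hlt : ∀ r ∈ F, r ≠ p → a * (r.1 - p.1) + b * (r.2 - p.2) < 0 := by
      intro r hr hrp
      refine lt_of_le_of_ne (hle r hr) fun h => htie r hr hrp ?_
      rw [hab, hab]
      linarith
    have hne' : (F \ {p}).Nonempty := by
      by_contra h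
      rw [Set.not_nonempty_iff_eq_empty, Set.sdiff_eq_empty] at h
      exact hF ((collinear_singleton ℝ p).subset h)
    set s : ℝ × ℝ → ℝ := fun r => (a * (r.2 - p.2) - b * (r.1 - p.1)) /
      (a * (r.1 - p.1) + b * (r.2 - p.2)) with hs
    have key : ∀ u r : ℝ × ℝ, u ∈ F → u ≠ p → r ∈ F → r ≠ p → s u ≤ s r →
        0 ≤ cross (u - p) (r - p) := by
      intro u r hu hup hr hrp hsur
      have h1 := hlt u hu hup
      have h2 := hlt r hr hrp
      simp only [hs] at hsur
      rw [← sub_nonneg, div_sub_div _ _ h2.ne h1.ne, le_div_iff₀ (mul_pos_of_neg_of_neg h2 h1)]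
        at hsur
      simp only [cross, Prod.fst_sub, Prod.snd_sub]
      have : 0 ≤ (a ^ 2 + b ^ 2) *
        ((u.1 - p.1) * (r.2 - p.2) - (u.2 - p.2) * (r.1 - p.1)) := by linarith
      exact nonneg_of_mul_nonneg_right this hpos
    have hcp : ∀ u : ℝ × ℝ, cross u (p - p) = 0 := by simp [cross]
    have hswap : ∀ u v : ℝ × ℝ, cross u v = - cross v u := by
      intro u v
      simp only [cross]
      ring
    obtain ⟨u, ⟨hu, hup⟩, humin⟩ := Set.exists_min_image (F \ {p}) s hfin.sdiff hne'
    obtain ⟨w, ⟨hw, hwp⟩, hwmax⟩ := Set.exists_max_image (F \ {p}) s hfin.sdiff hne'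
    have hU : ∀ r ∈ F, 0 ≤ cross (u - p) (r - p) := by
      intro r hr
      by_cases hrp : r = p
      · rw [hrp, hcp]
      · exact key u r hu hup hr hrp (humin r ⟨hr, hrp⟩)
    have hW : ∀ r ∈ F, 0 ≤ cross (r - p) (w - p) := by
      intro r hr
      by_cases hrp : r = p
      · rw [hrp, hswap, hcp, neg_zero]
      · exact key r w hr hrp hw hwp (hwmax r ⟨hr, hrp⟩)
    by_cases hzu : cross (u - p) (z - p) < 0
    · exact ⟨p, hp, u, hu, fun h => hup h.symm, hU, hzu⟩
    by_cases hzw : cross (z - p) (w - p) < 0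
    · refine ⟨w, hw, p, hp, hwp, fun r hr => ?_, ?_⟩
      · have := hW r hr
        simp only [cross, Prod.fst_sub, Prod.snd_sub] at this ⊢
        linarith
      · simp only [cross, Prod.fst_sub, Prod.snd_sub] at hzw ⊢
        linarith
    exfalso
    push Not at hzu hzw
    have hfu := hlt u hu hup
    have hfw := hlt w hw hwp
    have hid : ∀ x : ℝ × ℝ, cross (u - p) (w - p) * (a * (x.1 - p.1) + b * (x.2 - p.2)) =
        cross (x - p) (w - p) * (a * (u.1 - p.1) + b * (u.2 - p.2)) +
        cross (u - p) (x - p) * (a * (w.1 - p.1) + b * (w.2 - p.2)) := by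
      intro x
      simp only [cross, Prod.fst_sub, Prod.snd_sub]
      ring
    rcases (hU w hw).eq_or_lt with h0 | h0
    · apply hF
      refine collinear_of_cross_eq_zero (p := p) (u := u - p) (sub_ne_zero.2 hup) fun r hr => ?_
      have h1 := hid r
      have h2 := hU r hr
      have h3 := hW r hr
      rw [← h0, zero_mul] at h1
      have h4 := mul_nonpos_of_nonneg_of_nonpos h2 hfw.le
      have h5 := mul_nonpos_of_nonneg_of_nonpos h3 hfu.le
      have h6 : cross (u - p) (r - p) * (a * (w.1 - p.1) + b * (w.2 - p.2)) = 0 := by linarith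
      exact (mul_eq_zero.1 h6).resolve_right hfw.ne
    · have h1 := hid z
      have h2 := mul_pos h0 hzp
      have h4 := mul_nonpos_of_nonneg_of_nonpos hzu hfw.le
      have h5 := mul_nonpos_of_nonneg_of_nonpos hzw hfu.le
      linarith

theorem collinear_convexHull {F : Set (ℝ × ℝ)} (h : Collinear ℝ F) :
    Collinear ℝ (convexHull ℝ F) := by
  unfold Collinear at *
  rwa [← direction_affineSpan, affineSpan_convexHull, direction_affineSpan]

theorem toR_injective : Function.Injective toR := by
  intro p q h
  simp only [toR, Prod.mk.injEq, Int.cast_inj] at h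
  exact Prod.ext h.1 h.2

theorem finite_latticePts {A : Set (ℝ × ℝ)} (hA : Bornology.IsBounded A) :
    (latticePts A).Finite := by
  obtain ⟨R, hR⟩ := hA.subset_closedBall 0
  refine ((Set.finite_Icc (-⌈R⌉) ⌈R⌉).prod (Set.finite_Icc (-⌈R⌉) ⌈R⌉)).subset fun p hp => ?_
  have h := hR hp
  rw [mem_closedBall_zero_iff, Prod.norm_def, max_le_iff] at h
  simp only [toR, Real.norm_eq_abs, abs_le] at h
  have hc := Int.le_ceil R
  refine ⟨⟨?_, ?_⟩, ⟨?_, ?_⟩⟩ <;>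
    · rify
      linarith [h.1.1, h.1.2, h.2.1, h.2.2]

/-- A half-plane bounded by a line in direction `u` is convex. -/
theorem convex_cross_ge (u : ℝ × ℝ) (c : ℝ) : Convex ℝ {x | c ≤ cross u x} := by
  refine convex_halfSpace_ge ⟨fun x y => ?_, fun t x => ?_⟩ c
  · simp only [cross, Prod.fst_add, Prod.snd_add]
    ring
  · simp only [cross, Prod.smul_fst, Prod.smul_snd, smul_eq_mul]
    ring

theorem cross_lt_of_mem_interior {A : Set (ℝ × ℝ)} {u : ℝ × ℝ} {c : ℝ} (hu : u ≠ 0)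
    (hA : ∀ x ∈ A, c ≤ cross u x) {x : ℝ × ℝ} (hx : x ∈ interior A) : c < cross u x := by
  have ht : Filter.Tendsto (fun t : ℝ => x + t • ((u.2, -u.1) : ℝ × ℝ)) (nhds 0) (nhds x) := by
    have : Continuous (fun t : ℝ => x + t • ((u.2, -u.1) : ℝ × ℝ)) := by fun_prop
    simpa using this.tendsto 0
  have hev := ht.eventually (mem_interior_iff_mem_nhds.1 hx)
  obtain ⟨ε, hε, hball⟩ := Metric.eventually_nhds_iff.1 hev
  have hmem := hA _ (hball (y := ε / 2) (by
    rw [Real.dist_eq, sub_zero, abs_of_pos (by positivity)]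
    linarith))
  simp only [cross, Prod.fst_add, Prod.snd_add, Prod.smul_fst, Prod.smul_snd, smul_eq_mul] at hmem
  have hn := sq_add_sq_pos hu
  simp only [cross]
  nlinarith [mul_pos hε hn]

/-- If no lattice point of the interior of a convex set lies beyond the line through the interior
lattice points `p` and `p + e`, with `e` primitive, then every lattice point of the set is at
lattice distance at most one beyond this line. -/
theorem neg_one_le_of_interior_latticePts {A : Set (ℝ × ℝ)} (hA : Convex ℝ A) {p e v : ℤ × ℤ}
    (he : IsCoprime e.1 e.2) (hp : toR p ∈ interior A) (hq : toR (p + e) ∈ interior A)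
    (hside : ∀ w : ℤ × ℤ, toR w ∈ interior A →
      0 ≤ e.1 * (w.2 - p.2) - e.2 * (w.1 - p.1))
    (hv : toR v ∈ A) : -1 ≤ e.1 * (v.2 - p.2) - e.2 * (v.1 - p.1) := by
  by_contra! hlt
  obtain ⟨α, β, hαβ⟩ := he
  set h : ℤ := -(e.1 * (v.2 - p.2) - e.2 * (v.1 - p.1)) with hh
  have hh2 : 2 ≤ h := by omega
  set x : ℤ := α * (v.1 - p.1) + β * (v.2 - p.2) with hx
  have hv1 : v.1 - p.1 = x * e.1 + h * β := by
    rw [hx, hh]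
    linear_combination (-(v.1 - p.1)) * hαβ
  have hv2 : v.2 - p.2 = x * e.2 - h * α := by
    rw [hx, hh]
    linear_combination (-(v.2 - p.2)) * hαβ
  obtain ⟨m, hm1, hm2⟩ : ∃ m : ℤ, x ≤ m * h ∧ m * h - x ≤ h - 1 := by
    refine ⟨-((-x) / h), ?_, ?_⟩
    · have := Int.ediv_mul_le (-x) (show h ≠ 0 by omega)
      linarith
    · have := Int.lt_ediv_add_one_mul_self (-x) (show 0 < h by omega)
      linarith
  have hhR : (2 : ℝ) ≤ h := by exact_mod_cast hh2
  have hm1R : (x : ℝ) ≤ m * h := by exact_mod_cast hm1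
  have hm2R : (m : ℝ) * h - x ≤ h - 1 := by exact_mod_cast hm2
  have hv1R : (v.1 : ℝ) - p.1 = x * e.1 + h * β := by exact_mod_cast hv1
  have hv2R : (v.2 : ℝ) - p.2 = x * e.2 - h * α := by exact_mod_cast hv2
  have hh0 : (h : ℝ) ≠ 0 := by linarith
  have hh1 : (h : ℝ) - 1 ≠ 0 := by linarith
  set μ : ℝ := (m * h - x) / (h - 1) with hμ
  have hμ0 : 0 ≤ μ := div_nonneg (by linarith) (by linarith)
  have hμ1 : μ ≤ 1 := (div_le_one (by linarith)).2 (by linarith)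
  have hy : (1 - μ) • toR p + μ • toR (p + e) ∈ interior A :=
    hA.interior hp hq (by linarith) hμ0 (by ring)
  have hw := hA.combo_interior_self_mem_interior hy hv (a := 1 - 1 / (h : ℝ)) (b := 1 / (h : ℝ))
    (by rw [sub_pos, div_lt_one (by linarith)]; linarith) (by positivity) (by ring)
  have hweq : (1 - 1 / (h : ℝ)) • ((1 - μ) • toR p + μ • toR (p + e)) + (1 / (h : ℝ)) • toR v =
      toR (p.1 + m * e.1 + β, p.2 + m * e.2 - α) := by
    have hμh : μ * (h - 1) = m * h - x := div_mul_cancel₀ _ hh1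
    ext
    · simp only [toR, Prod.fst_add, Prod.snd_add, Prod.smul_fst, smul_eq_mul, Int.cast_add,
        Int.cast_mul]
      field_simp
      linear_combination hv1R + e.1 * hμh
    · simp only [toR, Prod.fst_add, Prod.snd_add, Prod.smul_snd, smul_eq_mul, Int.cast_add,
        Int.cast_mul, Int.cast_sub]
      field_simp
      linear_combination hv2R + e.2 * hμh
  rw [hweq] at hw
  have := hside _ hw
  dsimp only at this
  have h1 : e.1 * (p.2 + m * e.2 - α - p.2) - e.2 * (p.1 + m * e.1 + β - p.1) = -1 := by
    linear_combination -hαβ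
  omega

theorem stmt6 (Δ : Set (ℝ × ℝ))
    (hpoly : IsLatticePolygon Δ) (hdim : ¬ Collinear ℝ Δ)
    (hdim1 : ¬ Collinear ℝ (interiorHull Δ))
    (d : ℕ) (hd : 2 ≤ d) :
    interiorHull (((d : ℝ) - 1) • interiorHull Δ) + Δ ⊆ (d : ℝ) • interiorHull Δ := by
  obtain ⟨S, hS⟩ := hpoly
  have hconv : Convex ℝ Δ := hS ▸ convex_convexHull ℝ _
  have hbdd : Bornology.IsBounded Δ := by
    rw [hS, isBounded_convexHull]
    exact (S.finite_toSet.image _).isBounded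
  have hfin : (toR '' latticePts (interior Δ)).Finite :=
    (finite_latticePts (hbdd.subset interior_subset)).image _
  have hd0 : (d : ℝ) ≠ 0 := by positivity
  rintro _ ⟨y, hy, v, hv, rfl⟩
  rw [Set.mem_smul_set_iff_inv_smul_mem₀ hd0]
  by_contra hz
  obtain ⟨_, ⟨p, hp, rfl⟩, _, ⟨q, hq, rfl⟩, hpq, hF, hzneg⟩ :=
    exists_edge_separating hfin (fun h => hdim1 (collinear_convexHull h)) hz
  -- the primitive direction of the separating edge
  obtain ⟨g, e, hg, he, hge1, hge2⟩ : ∃ (g : ℤ) (e : ℤ × ℤ), 1 ≤ g ∧ IsCoprime e.1 e.2 ∧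
      q.1 - p.1 = g * e.1 ∧ q.2 - p.2 = g * e.2 := by
    have hg : 0 < Int.gcd (q.1 - p.1) (q.2 - p.2) := by
      rw [Nat.pos_iff_ne_zero, Ne, Int.gcd_eq_zero_iff]
      rintro ⟨h1, h2⟩
      exact hpq (congrArg toR (Prod.ext (by omega) (by omega)))
    obtain ⟨g, m, n, hg, hmn, h1, h2⟩ := Int.exists_gcd_one' hg
    exact ⟨g, (m, n), by omega, Int.isCoprime_iff_gcd_eq_one.2 hmn, by rw [h1, mul_comm],
      by rw [h2, mul_comm]⟩
  have hgR : (1 : ℝ) ≤ g := by exact_mod_cast hg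
  have hge1R : (q.1 : ℝ) - p.1 = g * e.1 := by exact_mod_cast hge1
  have hge2R : (q.2 : ℝ) - p.2 = g * e.2 := by exact_mod_cast hge2
  have hcross : ∀ x : ℝ × ℝ, cross (toR q - toR p) (x - toR p) =
      g * (cross (toR e) x - cross (toR e) (toR p)) := by
    intro x
    simp only [cross, toR, Prod.fst_sub, Prod.snd_sub, hge1R, hge2R]
    ring
  have he0 : toR e ≠ 0 := by
    intro h0
    have h1 : e = 0 := toR_injective (h0.trans (by ext <;> simp [toR]))
    rw [h1] at he
    exact not_isCoprime_zero_zero he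
  have hpe : toR (p + e) ∈ interior Δ := by
    have hmem := hconv.interior hp hq (a := 1 - 1 / (g : ℝ)) (b := 1 / (g : ℝ))
      (by rw [sub_nonneg, div_le_one (by linarith)]; exact hgR) (by positivity) (by ring)
    have heq : (1 - 1 / (g : ℝ)) • toR p + (1 / (g : ℝ)) • toR q = toR (p + e) := by
      have hg0 : (g : ℝ) ≠ 0 := by linarith
      ext
      · simp only [toR, Prod.fst_add, Prod.snd_add, Prod.smul_fst, smul_eq_mul, Int.cast_add]
        field_simp
        linear_combination hge1R
      · simp only [toR, Prod.fst_add, Prod.snd_add, Prod.smul_snd, smul_eq_mul, Int.cast_add]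
        field_simp
        linear_combination hge2R
    rwa [heq] at hmem
  have hside : ∀ w : ℤ × ℤ, toR w ∈ interior Δ →
      cross (toR e) (toR p) ≤ cross (toR e) (toR w) := by
    intro w hw
    have := hF _ ⟨w, hw, rfl⟩
    rw [hcross] at this
    linarith [nonneg_of_mul_nonneg_right this (by linarith)]
  have hQ : ∀ x ∈ interiorHull Δ, cross (toR e) (toR p) ≤ cross (toR e) x := by
    refine fun x hx => convexHull_min ?_ (convex_cross_ge (toR e) _) hx
    rintro _ ⟨w, hw, rfl⟩
    exact hside w hw
  have hΔ : cross (toR e) (toR p) - 1 ≤ cross (toR e) v := by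
    rw [hS] at hv
    refine convexHull_min ?_ (convex_cross_ge (toR e) _) hv
    rintro _ ⟨w, hw, rfl⟩
    have hw' : toR w ∈ Δ := hS ▸ subset_convexHull ℝ _ ⟨w, hw, rfl⟩
    have := neg_one_le_of_interior_latticePts hconv he hp hpe (fun t ht => ?_) hw'
    · rify at this
      simp only [Set.mem_ofPred_eq, cross, toR]
      linarith
    · have := hside t ht
      simp only [cross, toR] at this
      rify
      linarith
  have hY : ((d : ℝ) - 1) * cross (toR e) (toR p) + 1 ≤ cross (toR e) y := by
    refine convexHull_min ?_ (convex_cross_ge (toR e) _) hy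
    rintro _ ⟨w, hw, rfl⟩
    have hd1 : (0 : ℝ) ≤ (d : ℝ) - 1 := by
      have : (2 : ℝ) ≤ d := by exact_mod_cast hd
      linarith
    have := cross_lt_of_mem_interior (c := ((d : ℝ) - 1) * cross (toR e) (toR p)) he0 ?_ hw
    · simp only [Set.mem_ofPred_eq, cross, toR] at this ⊢
      exact_mod_cast Int.add_one_le_iff.2 (by exact_mod_cast this)
    · rintro _ ⟨x, hx, rfl⟩
      have h1 := mul_le_mul_of_nonneg_left (hQ x hx) hd1
      simp only [cross, Prod.smul_fst, Prod.smul_snd, smul_eq_mul] at h1 ⊢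
      linarith
  rw [hcross] at hzneg
  have hz1 : cross (toR e) ((d : ℝ)⁻¹ • (y + v)) =
      (d : ℝ)⁻¹ * (cross (toR e) y + cross (toR e) v) := by
    simp only [cross, Prod.smul_fst, Prod.smul_snd, Prod.fst_add, Prod.snd_add, smul_eq_mul]
    ring
  have hz2 : cross (toR e) (toR p) ≤ cross (toR e) ((d : ℝ)⁻¹ • (y + v)) := by
    rw [hz1, inv_mul_eq_div, le_div_iff₀ (by positivity)]
    linarith
  have := mul_nonneg (by linarith : (0 : ℝ) ≤ g) (sub_nonneg.2 hz2)
  linarith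
end
end

section
/- Let Γ ⊂ ℝ² be a two-dimensional lattice polygon with exactly 3 lattice points on its boundary ∂Γ and such that Γ^{(1)} is one-dimensional (i.e. Γ is hyperelliptic). Set r = #(Γ ∩ ℤ²) − 3. Then r ≥ 2 and Γ is unimodularly equivalent to the triangle conv{(−1,1), (0,−1), (r,0)}. -/
open Pointwise

noncomputable section

/-- `Γ` is hyperelliptic: `Γ⁽¹⁾` is one-dimensional, i.e. contained in an affine
line and containing at least two points. -/
def IsHyperelliptic (Γ : Set (ℝ × ℝ)) : Prop :=
  Collinear ℝ (interiorHull Γ) ∧ (interiorHull Γ).Nontrivial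

/-- Affine map `x ↦ M x + v` on `ℝ²` induced by `M ∈ Mat₂(ℤ)`, `v ∈ ℤ²`. -/
def unimodMap (M : Matrix (Fin 2) (Fin 2) ℤ) (v : ℤ × ℤ) (x : ℝ × ℝ) : ℝ × ℝ :=
  ((M 0 0 : ℝ) * x.1 + (M 0 1 : ℝ) * x.2 + (v.1 : ℝ),
   (M 1 0 : ℝ) * x.1 + (M 1 1 : ℝ) * x.2 + (v.2 : ℝ))

def UnimodEquiv (P Q : Set (ℝ × ℝ)) : Prop :=
  ∃ (M : Matrix (Fin 2) (Fin 2) ℤ) (v : ℤ × ℤ), IsUnit M.det ∧ Q = unimodMap M v '' P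


/-- Twice the signed area of the triangle `A B p`. -/
def orient {R : Type*} [CommRing R] (A B p : R × R) : R :=
  (B.1 - A.1) * (p.2 - A.2) - (B.2 - A.2) * (p.1 - A.1)

/-- Membership in a counterclockwise triangle. -/
def InTri {R : Type*} [CommRing R] [LinearOrder R] (A B C p : R × R) : Prop :=
  0 ≤ orient A B p ∧ 0 ≤ orient B C p ∧ 0 ≤ orient C A p

/-- Membership in the interior of a counterclockwise triangle. -/
def InTriStrict (A B C p : ℤ × ℤ) : Prop :=
  0 < orient A B p ∧ 0 < orient B C p ∧ 0 < orient C A p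

/-- Orientation-preserving affine automorphisms of `ℤ²`. -/
def IsSLMap (φ : ℤ × ℤ → ℤ × ℤ) : Prop :=
  ∃ (M : Matrix (Fin 2) (Fin 2) ℤ) (v : ℤ × ℤ), M 0 0 * M 1 1 - M 0 1 * M 1 0 = 1 ∧
    ∀ p, φ p = (M 0 0 * p.1 + M 0 1 * p.2 + v.1, M 1 0 * p.1 + M 1 1 * p.2 + v.2)

/-- The triangle is equivalent to one with vertices `(-1, 1)`, `(0, -1)`, `(n, 0)`, `n ≥ 2`. -/
def HasNormalForm (A B C : ℤ × ℤ) : Prop :=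
  ∃ φ, IsSLMap φ ∧ ∃ n : ℕ, 2 ≤ n ∧
    ({φ A, φ B, φ C} : Set (ℤ × ℤ)) = {(-1, 1), (0, -1), ((n : ℤ), 0)}

/-- A counterclockwise lattice triangle whose only boundary lattice points are its vertices. -/
structure IsPrimitive (A B C : ℤ × ℤ) : Prop where
  pos : 0 < orient A B C
  vertex_or_strict : ∀ p, InTri A B C p → p = A ∨ p = B ∨ p = C ∨ InTriStrict A B C p

/-- A primitive triangle whose interior lattice points lie on the first coordinate axis, among
them `(0, 0)` and `(1, 0)`. -/
structure IsAxial (A B C : ℤ × ℤ) : Prop extends IsPrimitive A B C where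
  zero_mem : InTriStrict A B C (0, 0)
  one_mem : InTriStrict A B C (1, 0)
  snd_eq_zero : ∀ p, InTriStrict A B C p → p.2 = 0

theorem IsSLMap.comp {φ ψ : ℤ × ℤ → ℤ × ℤ} (hφ : IsSLMap φ) (hψ : IsSLMap ψ) :
    IsSLMap (fun p => φ (ψ p)) := by
  obtain ⟨M, v, hM, h⟩ := hφ
  obtain ⟨N, w, hN, k⟩ := hψ
  refine ⟨M * N, φ w, ?_, fun p => ?_⟩
  · have := Matrix.det_mul M N
    rw [Matrix.det_fin_two, Matrix.det_fin_two, Matrix.det_fin_two, hM, hN] at this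
    simpa using this
  · simp only [h, k, Matrix.mul_apply, Fin.sum_univ_two]
    ext <;> simp only <;> ring

theorem IsSLMap.orient_apply {φ : ℤ × ℤ → ℤ × ℤ} (hφ : IsSLMap φ) (A B p : ℤ × ℤ) :
    orient (φ A) (φ B) (φ p) = orient A B p := by
  obtain ⟨M, v, hM, h⟩ := hφ
  simp only [h, orient]
  linear_combination ((B.1 - A.1) * (p.2 - A.2) - (B.2 - A.2) * (p.1 - A.1)) * hM

theorem IsSLMap.bijective {φ : ℤ × ℤ → ℤ × ℤ} (hφ : IsSLMap φ) : Function.Bijective φ := by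
  obtain ⟨M, v, hM, h⟩ := hφ
  constructor
  · intro p q hpq
    rw [h, h, Prod.mk.injEq] at hpq
    obtain ⟨h1, h2⟩ := hpq
    ext
    · linear_combination M 1 1 * h1 - M 0 1 * h2 - (p.1 - q.1) * hM
    · linear_combination M 0 0 * h2 - M 1 0 * h1 - (p.2 - q.2) * hM
  · intro q
    refine ⟨(M 1 1 * (q.1 - v.1) - M 0 1 * (q.2 - v.2),
      M 0 0 * (q.2 - v.2) - M 1 0 * (q.1 - v.1)), ?_⟩
    rw [h]
    ext
    · linear_combination (q.1 - v.1) * hM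
    · linear_combination (q.2 - v.2) * hM

theorem IsSLMap.inTri_iff {φ : ℤ × ℤ → ℤ × ℤ} (hφ : IsSLMap φ) (A B C p : ℤ × ℤ) :
    InTri (φ A) (φ B) (φ C) (φ p) ↔ InTri A B C p := by
  simp only [InTri, hφ.orient_apply]

theorem IsSLMap.inTriStrict_iff {φ : ℤ × ℤ → ℤ × ℤ} (hφ : IsSLMap φ) (A B C p : ℤ × ℤ) :
    InTriStrict (φ A) (φ B) (φ C) (φ p) ↔ InTriStrict A B C p := by
  simp only [InTriStrict, hφ.orient_apply]

theorem IsPrimitive.map {A B C : ℤ × ℤ} (h : IsPrimitive A B C) {φ : ℤ × ℤ → ℤ × ℤ}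
    (hφ : IsSLMap φ) : IsPrimitive (φ A) (φ B) (φ C) where
  pos := by rw [hφ.orient_apply]; exact h.pos
  vertex_or_strict p hp := by
    obtain ⟨q, rfl⟩ := hφ.bijective.2 p
    rw [hφ.inTriStrict_iff]
    simpa only [hφ.bijective.1.eq_iff] using h.vertex_or_strict q ((hφ.inTri_iff _ _ _ _).1 hp)

theorem HasNormalForm.of_map {A B C : ℤ × ℤ} {φ : ℤ × ℤ → ℤ × ℤ} (hφ : IsSLMap φ)
    (h : HasNormalForm (φ A) (φ B) (φ C)) : HasNormalForm A B C := by
  obtain ⟨ψ, hψ, hn⟩ := h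
  exact ⟨_, hψ.comp hφ, hn⟩

theorem HasNormalForm.rotate {A B C : ℤ × ℤ} (h : HasNormalForm B C A) :
    HasNormalForm A B C := by
  obtain ⟨φ, hφ, n, hn, he⟩ := h
  refine ⟨φ, hφ, n, hn, ?_⟩
  rw [← he]
  ext p
  simp only [Set.mem_insert_iff, Set.mem_singleton_iff]
  tauto

theorem orient_rotate {R : Type*} [CommRing R] (A B C : R × R) :
    orient B C A = orient A B C := by
  simp only [orient]
  ring

theorem inTriStrict_rotate {A B C p : ℤ × ℤ} : InTriStrict B C A p ↔ InTriStrict A B C p := by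
  simp only [InTriStrict]
  tauto

theorem IsAxial.rotate {A B C : ℤ × ℤ} (h : IsAxial A B C) : IsAxial B C A where
  pos := by rw [orient_rotate]; exact h.pos
  vertex_or_strict p hp := by
    have := h.vertex_or_strict p ⟨hp.2.2, hp.1, hp.2.1⟩
    rw [inTriStrict_rotate]
    tauto
  zero_mem := inTriStrict_rotate.2 h.zero_mem
  one_mem := inTriStrict_rotate.2 h.one_mem
  snd_eq_zero p hp := h.snd_eq_zero p (inTriStrict_rotate.1 hp)

/-- The half-turn exchanging `(0, 0)` and `(1, 0)`. -/
def halfTurn (p : ℤ × ℤ) : ℤ × ℤ := (1 - p.1, -p.2)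

theorem isSLMap_halfTurn : IsSLMap halfTurn :=
  ⟨!![-1, 0; 0, -1], (1, 0), by simp, fun p => by
    ext <;> simp [halfTurn, sub_eq_add_neg, add_comm]⟩

theorem IsAxial.halfTurn {A B C : ℤ × ℤ} (h : IsAxial A B C) :
    IsAxial (halfTurn A) (halfTurn B) (halfTurn C) where
  toIsPrimitive := h.toIsPrimitive.map isSLMap_halfTurn
  zero_mem := by
    have := (isSLMap_halfTurn.inTriStrict_iff A B C (1, 0)).2 h.one_mem
    simpa [_root_.halfTurn] using this
  one_mem := by
    have := (isSLMap_halfTurn.inTriStrict_iff A B C (0, 0)).2 h.zero_mem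
    simpa [_root_.halfTurn] using this
  snd_eq_zero p hp := by
    obtain ⟨q, rfl⟩ := isSLMap_halfTurn.bijective.2 p
    have := h.snd_eq_zero q ((isSLMap_halfTurn.inTriStrict_iff _ _ _ _).1 hp)
    simp [_root_.halfTurn, this]

theorem orient_pos_of_height {U V A : ℤ × ℤ} {k : ℤ} (hA : 2 ≤ A.2)
    (hk : A.1 ≤ A.2 * k) (hk' : A.2 * k ≤ A.1 + A.2 - 1) (h0 : 0 < orient U V (0, 0))
    (h1 : 0 < orient U V (1, 0)) (h2 : 0 ≤ orient U V A) : 0 < orient U V (k, 1) := by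
  have key : A.2 * orient U V (k, 1) = orient U V A
      + (A.1 + A.2 - 1 - A.2 * k) * orient U V (0, 0)
      + (A.2 * k - A.1) * orient U V (1, 0) := by
    simp only [orient]
    ring
  refine pos_of_mul_pos_right (a := A.2) ?_ (by omega)
  rw [key]
  rcases hk.lt_or_eq with hk | hk
  · have := mul_pos (sub_pos.2 hk) h1
    have := mul_nonneg (sub_nonneg.2 hk') h0.le
    linarith
  · have := mul_nonneg (sub_nonneg.2 hk.le) h1.le
    have : 0 < A.1 + A.2 - 1 - A.2 * k := by omega
    have := mul_pos this h0
    linarith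

theorem IsAxial.snd_le_one {A B C : ℤ × ℤ} (h : IsAxial A B C) : A.2 ≤ 1 := by
  by_contra! hA
  obtain ⟨k, hk, hk'⟩ : ∃ k, A.1 ≤ A.2 * k ∧ A.2 * k ≤ A.1 + A.2 - 1 := by
    refine ⟨(A.1 + A.2 - 1) / A.2, ?_, ?_⟩
    · have := Int.mul_ediv_add_emod (A.1 + A.2 - 1) A.2
      have := Int.emod_lt_of_pos (A.1 + A.2 - 1) (b := A.2) (by omega)
      omega
    · exact Int.mul_ediv_self_le (by omega)
  have h0 := h.zero_mem
  have h1 := h.one_mem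
  have hs : InTriStrict A B C (k, 1) :=
    ⟨orient_pos_of_height hA hk hk' h0.1 h1.1 (by simp only [orient]; ring_nf; rfl),
      orient_pos_of_height hA hk hk' h0.2.1 h1.2.1 (by rw [orient_rotate]; exact h.pos.le),
      orient_pos_of_height hA hk hk' h0.2.2 h1.2.2 (by simp only [orient]; ring_nf; rfl)⟩
  simpa using h.snd_eq_zero _ hs

theorem IsAxial.neg_one_le_snd {A B C : ℤ × ℤ} (h : IsAxial A B C) : -1 ≤ A.2 := by
  have := h.halfTurn.snd_le_one
  simp only [_root_.halfTurn] at this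
  omega

theorem IsAxial.not_horizontal_edge {A B C : ℤ × ℤ} (h : IsAxial A B C) (hA : A.2 = 1)
    (hB : B.2 = 1) (hC : C.2 = -1) : False := by
  have h0 := h.zero_mem.2.1
  have h1 := h.one_mem.2.2
  obtain ⟨a, a'⟩ := A
  obtain ⟨b, b'⟩ := B
  obtain ⟨c, c'⟩ := C
  simp only at hA hB hC
  subst hA hB hC
  simp only [orient] at h0 h1
  have hT := h.vertex_or_strict (a - 1, 1) (by
    refine ⟨?_, ?_, ?_⟩ <;> simp only [orient] <;> linarith)
  rcases hT with hT | hT | hT | hT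
  · simp at hT
  · simp only [Prod.mk.injEq] at hT; omega
  · simp at hT
  · simpa using h.snd_eq_zero _ hT

theorem IsAxial.hasNormalForm_of_snd {A B C : ℤ × ℤ} (h : IsAxial A B C) (hA : A.2 = 1)
    (hB : B.2 = -1) (hC : C.2 = 0) : HasNormalForm A B C := by
  have h0 := h.zero_mem.1
  have h1 := h.one_mem.2.1
  have hD := h.pos
  obtain ⟨a, a'⟩ := A
  obtain ⟨b, b'⟩ := B
  obtain ⟨c, c'⟩ := C
  simp only at hA hB hC
  subst hA hB hC
  simp only [orient] at h0 h1 hD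
  obtain ⟨m, hm | hm⟩ := (a + b).even_or_odd'
  · have hT := h.vertex_or_strict (m, 0) (by
      refine ⟨?_, ?_, ?_⟩ <;> simp only [orient] <;> linarith)
    rcases hT with hT | hT | hT | hT
    · simp at hT
    · simp at hT
    · simp only [Prod.mk.injEq] at hT; omega
    · have := hT.1
      simp only [orient] at this
      omega
  · refine ⟨fun p => (p.1 + (m - a) * p.2 - m - 1, p.2),
      ⟨!![1, m - a; 0, 1], (-m - 1, 0), by simp, fun p => by
        ext
        · simp; ring
        · simp⟩, (c - m - 1).toNat, by omega, ?_⟩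
    have e1 : a + (m - a) * 1 - m - 1 = -1 := by ring
    have e2 : b + (m - a) * (-1) - m - 1 = 0 := by linarith
    have e3 : c + (m - a) * 0 - m - 1 = ((c - m - 1).toNat : ℤ) := by
      rw [Int.toNat_of_nonneg (by omega)]; ring
    rw [← e3]
    simp only [e1, e2]

theorem IsAxial.hasNormalForm_of_snd_eq_zero {A B C : ℤ × ℤ} (h : IsAxial A B C)
    (hAB : A.2 = 1 ∧ B.2 = -1 ∨ A.2 = -1 ∧ B.2 = 1) (hC : C.2 = 0) : HasNormalForm A B C := by
  rcases hAB with ⟨hA, hB⟩ | ⟨hA, hB⟩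
  · exact h.hasNormalForm_of_snd hA hB hC
  · exact .of_map isSLMap_halfTurn (h.halfTurn.hasNormalForm_of_snd
      (by simp [_root_.halfTurn, hA]) (by simp [_root_.halfTurn, hB])
      (by simp [_root_.halfTurn, hC]))

theorem IsAxial.hasNormalForm {A B C : ℤ × ℤ} (h : IsAxial A B C) : HasNormalForm A B C := by
  have hw : orient B C (0, 0) * A.2 + orient C A (0, 0) * B.2 + orient A B (0, 0) * C.2 = 0 := by
    simp only [orient]
    ring
  obtain ⟨w₃, w₁, w₂⟩ := h.zero_mem
  have e₁ : ∀ {A B C : ℤ × ℤ}, IsAxial A B C → A.2 = -1 ∨ A.2 = 0 ∨ A.2 = 1 := fun h => by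
    have := h.snd_le_one
    have := h.neg_one_le_snd
    omega
  have k : ∀ {A B C : ℤ × ℤ}, IsAxial A B C → A.2 = -1 → B.2 = -1 → C.2 = 1 → False :=
    fun h hA hB hC => h.halfTurn.not_horizontal_edge
      (by simp [_root_.halfTurn, hA]) (by simp [_root_.halfTurn, hB])
      (by simp [_root_.halfTurn, hC])
  have hp := h.pos
  rcases e₁ h with hA | hA | hA <;> rcases e₁ h.rotate with hB | hB | hB <;>
    rcases e₁ h.rotate.rotate with hC | hC | hC <;>
    first
    | (exfalso; rw [hA, hB, hC] at hw; linarith)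
    | (exfalso; simp [orient, hA, hB, hC] at hp; done)
    | exact h.hasNormalForm_of_snd_eq_zero (by tauto) hC
    | exact (h.rotate.hasNormalForm_of_snd_eq_zero (by tauto) hA).rotate
    | exact (h.rotate.rotate.hasNormalForm_of_snd_eq_zero (by tauto) hB).rotate.rotate
    | exact (h.not_horizontal_edge hA hB hC).elim
    | exact (h.rotate.not_horizontal_edge hB hC hA).elim
    | exact (h.rotate.rotate.not_horizontal_edge hC hA hB).elim
    | exact (k h hA hB hC).elim
    | exact (k h.rotate hB hC hA).elim
    | exact (k h.rotate.rotate hC hA hB).elim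

/-- Any line through two lattice points can be moved to the first coordinate axis. -/
theorem exists_isSLMap_axis {P Q : ℤ × ℤ} (hPQ : P ≠ Q) :
    ∃ φ, IsSLMap φ ∧ φ P = (0, 0) ∧ ∃ g : ℤ, 1 ≤ g ∧ φ Q = (g, 0) := by
  set d : ℤ × ℤ := Q - P with hd
  have hd1 : d.1 = Q.1 - P.1 := rfl
  have hd2 : d.2 = Q.2 - P.2 := rfl
  have hg : Int.gcd d.1 d.2 ≠ 0 := fun h0 => by
    rw [Int.gcd_eq_zero_iff] at h0
    exact hPQ (by ext <;> omega)
  obtain ⟨x, hx⟩ := Int.gcd_dvd_left d.1 d.2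
  obtain ⟨y, hy⟩ := Int.gcd_dvd_right d.1 d.2
  have hb := Int.gcd_eq_gcd_ab d.1 d.2
  set g := Int.gcd d.1 d.2
  set s := Int.gcdA d.1 d.2
  set t := Int.gcdB d.1 d.2
  have hst : s * x + t * y = 1 := by
    have hg' : (g : ℤ) ≠ 0 := by exact_mod_cast hg
    apply mul_left_cancel₀ hg'
    linear_combination -hb - s * hx - t * hy
  refine ⟨fun p => (s * (p.1 - P.1) + t * (p.2 - P.2), -y * (p.1 - P.1) + x * (p.2 - P.2)),
    ⟨!![s, t; -y, x], (-s * P.1 - t * P.2, y * P.1 - x * P.2), ?_, fun p => ?_⟩, ?_,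
    g, by omega, ?_⟩
  · simp; linear_combination hst
  · ext <;> simp <;> ring
  · simp
  · ext
    · simp only [← hd1, ← hd2]; linear_combination -hb
    · simp only [← hd1, ← hd2]; linear_combination -y * hx + x * hy

theorem orient_pos_one {U V : ℤ × ℤ} {g : ℤ} (hg : 1 ≤ g) (h0 : 0 < orient U V (0, 0))
    (h1 : 0 < orient U V (g, 0)) : 0 < orient U V (1, 0) := by
  refine pos_of_mul_pos_right (a := g) ?_ (by omega)
  have key : g * orient U V (1, 0) = (g - 1) * orient U V (0, 0) + orient U V (g, 0) := by
    simp only [orient]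
    ring
  rw [key]
  have := mul_nonneg (sub_nonneg.2 hg) h0.le
  linarith

theorem IsPrimitive.hasNormalForm {A B C P Q : ℤ × ℤ} (h : IsPrimitive A B C)
    (hPQ : P ≠ Q) (hP : InTriStrict A B C P) (hQ : InTriStrict A B C Q)
    (hcol : ∀ p, InTriStrict A B C p → orient P Q p = 0) : HasNormalForm A B C := by
  obtain ⟨φ, hφ, h0, g, hg, hQg⟩ := exists_isSLMap_axis hPQ
  rw [← hφ.inTriStrict_iff, h0] at hP
  rw [← hφ.inTriStrict_iff, hQg] at hQ
  refine .of_map hφ (IsAxial.hasNormalForm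
    ⟨h.map hφ, hP, ⟨orient_pos_one hg hP.1 hQ.1, orient_pos_one hg hP.2.1 hQ.2.1,
      orient_pos_one hg hP.2.2 hQ.2.2⟩, fun p hp => ?_⟩)
  obtain ⟨q, rfl⟩ := hφ.bijective.2 p
  have := hcol q ((hφ.inTriStrict_iff _ _ _ _).1 hp)
  rw [← hφ.orient_apply, h0, hQg] at this
  simp only [orient, sub_zero, zero_mul] at this
  exact (mul_eq_zero.1 this).resolve_left (by omega)

theorem orient_toR (A B p : ℤ × ℤ) : orient (toR A) (toR B) (toR p) = orient A B p := by
  simp [orient, toR]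

theorem inTri_toR_iff {A B C p : ℤ × ℤ} :
    InTri (toR A) (toR B) (toR C) (toR p) ↔ InTri A B C p := by
  simp only [InTri, orient_toR, Int.cast_nonneg_iff]

theorem convex_orient_nonneg (A B : ℝ × ℝ) : Convex ℝ {p | 0 ≤ orient A B p} := by
  intro x hx y hy a b ha hb hab
  have key : orient A B (a • x + b • y) = a * orient A B x + b * orient A B y := by
    simp only [orient, Prod.fst_add, Prod.snd_add, Prod.smul_fst, Prod.smul_snd, smul_eq_mul]
    linear_combination ((B.1 - A.1) * A.2 - (B.2 - A.2) * A.1) * hab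
  rw [Set.mem_ofPred_eq, key]
  exact add_nonneg (mul_nonneg ha hx) (mul_nonneg hb hy)

theorem orient_self_left {R : Type*} [CommRing R] (A B : R × R) : orient A B A = 0 := by
  simp [orient]

theorem orient_self_right {R : Type*} [CommRing R] (A B : R × R) : orient A B B = 0 := by
  simp only [orient]
  ring

theorem convexHull_subset_orient_nonneg {A B C : ℝ × ℝ} (h : 0 ≤ orient A B C) :
    convexHull ℝ {A, B, C} ⊆ {p | 0 ≤ orient A B p} := by
  refine convexHull_min ?_ (convex_orient_nonneg A B)
  simp [Set.insert_subset_iff, orient_self_left, orient_self_right, h]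

theorem convexHull_rotate (A B C : ℝ × ℝ) :
    convexHull ℝ {B, C, A} = convexHull ℝ {A, B, C} := by
  rw [Set.pair_comm C A, Set.insert_comm B A {C}]

theorem mem_convexHull_iff_inTri {A B C p : ℝ × ℝ} (h : 0 < orient A B C) :
    p ∈ convexHull ℝ {A, B, C} ↔ InTri A B C p := by
  have hB : 0 < orient B C A := by rwa [orient_rotate]
  have hC : 0 < orient C A B := by rwa [orient_rotate]
  constructor
  · intro hp
    refine ⟨convexHull_subset_orient_nonneg h.le hp, convexHull_subset_orient_nonneg hB.le ?_,
      convexHull_subset_orient_nonneg hC.le ?_⟩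
    · rwa [convexHull_rotate]
    · rwa [convexHull_rotate, convexHull_rotate]
  · rintro ⟨h₁, h₂, h₃⟩
    have hsum := (convex_convexHull ℝ {A, B, C}).sum_mem (t := Finset.univ)
      (w := ![orient B C p / orient A B C, orient C A p / orient A B C,
        orient A B p / orient A B C]) (z := ![A, B, C])
      (by
        intro i _
        fin_cases i
        · exact div_nonneg h₂ h.le
        · exact div_nonneg h₃ h.le
        · exact div_nonneg h₁ h.le)
      (by
        simp only [Fin.sum_univ_three, Matrix.cons_val]
        field_simp
        simp only [orient]
        ring)
      (by
        intro i _
        apply subset_convexHull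
        fin_cases i <;> simp)
    convert hsum using 1
    simp only [Fin.sum_univ_three, Matrix.cons_val]
    ext
    · simp only [Prod.fst_add, Prod.smul_fst, smul_eq_mul]
      field_simp
      simp only [orient]
      ring
    · simp only [Prod.snd_add, Prod.smul_snd, smul_eq_mul]
      field_simp
      simp only [orient]
      ring

theorem orient_pos_of_mem_interior {A B C : ℝ × ℝ} (h : 0 < orient A B C) {p : ℝ × ℝ}
    (hp : p ∈ interior (convexHull ℝ {A, B, C})) : 0 < orient A B p := by
  have hev : ∀ᶠ t : ℝ in nhds 0, p + t • (p - C) ∈ convexHull ℝ {A, B, C} := by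
    have hc : ContinuousAt (fun t : ℝ => p + t • (p - C)) 0 := by fun_prop
    exact hc (by simpa using mem_interior_iff_mem_nhds.1 hp)
  obtain ⟨t, ht, hp'⟩ :=
    ((hev.filter_mono (nhdsWithin_le_nhds (s := Set.Ioi 0))).and self_mem_nhdsWithin).exists.imp
      fun _ h => h.symm
  have h₁ : 0 ≤ orient A B (p + t • (p - C)) := convexHull_subset_orient_nonneg h.le hp'
  have key : orient A B (p + t • (p - C)) = (1 + t) * orient A B p - t * orient A B C := by
    simp only [orient, Prod.fst_add, Prod.snd_add, Prod.smul_fst, Prod.smul_snd, smul_eq_mul,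
      Prod.fst_sub, Prod.snd_sub]
    ring
  have ht : (0 : ℝ) < t := ht
  have := mul_pos ht h
  refine pos_of_mul_pos_right (a := 1 + t) ?_ (by positivity)
  linarith

theorem inTriStrict_of_mem_interior {A B C p : ℤ × ℤ} (h : 0 < orient A B C)
    (hp : toR p ∈ interior (convexHull ℝ {toR A, toR B, toR C})) : InTriStrict A B C p := by
  have hA : 0 < orient (toR A) (toR B) (toR C) := by rw [orient_toR]; exact_mod_cast h
  have hB : 0 < orient (toR B) (toR C) (toR A) := by rwa [orient_rotate]
  have hC : 0 < orient (toR C) (toR A) (toR B) := by rwa [orient_rotate]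
  have h₁ := orient_pos_of_mem_interior hA hp
  have h₂ := orient_pos_of_mem_interior hB (by rwa [convexHull_rotate])
  have h₃ := orient_pos_of_mem_interior hC (by rwa [convexHull_rotate, convexHull_rotate])
  rw [orient_toR, Int.cast_pos] at h₁ h₂ h₃
  exact ⟨h₁, h₂, h₃⟩

theorem collinear_triple_of_orient_eq_zero {A B C : ℝ × ℝ} (hAB : A ≠ B)
    (h : orient A B C = 0) : Collinear ℝ {A, B, C} := by
  rw [collinear_iff_of_mem (p₀ := A) (by simp)]
  refine ⟨B - A, ?_⟩
  simp only [orient] at h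
  have hC : ∃ r : ℝ, C = r • (B - A) +ᵥ A := by
    rcases ne_or_eq (B.1 - A.1) 0 with h1 | h1
    · refine ⟨(C.1 - A.1) / (B.1 - A.1), ?_⟩
      ext
      · simp; field_simp; ring
      · simp; field_simp; linear_combination h
    · have h2 : B.2 - A.2 ≠ 0 := fun h2 => hAB (by ext <;> linarith)
      refine ⟨(C.2 - A.2) / (B.2 - A.2), ?_⟩
      ext
      · simp; field_simp; linear_combination -h
      · simp; field_simp; ring
  rintro p (rfl | rfl | rfl)
  · exact ⟨0, by simp⟩
  · exact ⟨1, by simp⟩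
  · exact hC

theorem orient_eq_zero_of_collinear {s : Set (ℝ × ℝ)} (h : Collinear ℝ s) {A B p : ℝ × ℝ}
    (hA : A ∈ s) (hB : B ∈ s) (hp : p ∈ s) : orient A B p = 0 := by
  obtain ⟨v, hv⟩ := (collinear_iff_of_mem hA).1 h
  obtain ⟨b, rfl⟩ := hv B hB
  obtain ⟨c, rfl⟩ := hv p hp
  simp only [orient, vadd_eq_add, Prod.fst_add, Prod.snd_add, Prod.smul_fst, Prod.smul_snd,
    smul_eq_mul]
  ring

/-- A lattice polygon is the convex hull of the lattice points on its boundary. -/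
theorem IsLatticePolygon.eq_convexHull_frontier {P : Set (ℝ × ℝ)} (hP : IsLatticePolygon P) :
    P = convexHull ℝ (toR '' latticePts (frontier P)) := by
  obtain ⟨S, rfl⟩ := hP
  have hfin : (toR '' (S : Set (ℤ × ℤ))).Finite := S.finite_toSet.image _
  set P := convexHull ℝ (toR '' (S : Set (ℤ × ℤ)))
  have hclosed : IsClosed P := hfin.isClosed_convexHull ℝ
  have hcomp : IsCompact P := hfin.isCompact_convexHull ℝ
  have hconv : Convex ℝ P := convex_convexHull ℝ _
  have hext : P.extremePoints ℝ ⊆ toR '' (S : Set (ℤ × ℤ)) := extremePoints_convexHull_subset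
  apply Set.Subset.antisymm
  · have hsub : P.extremePoints ℝ ⊆ toR '' latticePts (frontier P) := fun x hx => by
      obtain ⟨p, -, rfl⟩ := hext hx
      refine ⟨p, ?_, rfl⟩
      rw [latticePts, Set.mem_ofPred_eq, hclosed.frontier_eq]
      exact ⟨hx.1, fun hi => Set.disjoint_left.1 (disjoint_interior_extremePoints P) hi hx⟩
    calc P = closure (convexHull ℝ (P.extremePoints ℝ)) :=
          (closure_convexHull_extremePoints hcomp hconv).symm
      _ = convexHull ℝ (P.extremePoints ℝ) := ((hfin.subset hext).isClosed_convexHull ℝ).closure_eq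
      _ ⊆ _ := convexHull_mono hsub
  · refine convexHull_min ?_ hconv
    rintro _ ⟨p, hp, rfl⟩
    exact hclosed.frontier_subset hp

theorem image_unimodMap_convexHull (M : Matrix (Fin 2) (Fin 2) ℤ) (v : ℤ × ℤ)
    (s : Set (ℝ × ℝ)) : unimodMap M v '' convexHull ℝ s = convexHull ℝ (unimodMap M v '' s) := by
  let L : ℝ × ℝ →ₗ[ℝ] ℝ × ℝ :=
    { toFun := fun x => (M 0 0 * x.1 + M 0 1 * x.2, M 1 0 * x.1 + M 1 1 * x.2)
      map_add' := fun x y => by ext <;> simp <;> ring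
      map_smul' := fun c x => by ext <;> simp <;> ring }
  have hL : unimodMap M v = (L.toAffineMap + AffineMap.const ℝ (ℝ × ℝ) (toR v) :) := by
    ext x <;> simp [L, unimodMap, toR]
  rw [hL, AffineMap.image_convexHull]

theorem unimodMap_injective {M : Matrix (Fin 2) (Fin 2) ℤ}
    (hM : M 0 0 * M 1 1 - M 0 1 * M 1 0 = 1) (v : ℤ × ℤ) :
    Function.Injective (unimodMap M v) := by
  have hM' : (M 0 0 * M 1 1 - M 0 1 * M 1 0 : ℝ) = 1 := by exact_mod_cast hM
  intro p q hpq
  simp only [unimodMap, Prod.mk.injEq] at hpq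
  obtain ⟨h1, h2⟩ := hpq
  ext
  · linear_combination (M 1 1 : ℝ) * h1 - M 0 1 * h2 - (p.1 - q.1) * hM'
  · linear_combination (M 0 0 : ℝ) * h2 - M 1 0 * h1 - (p.2 - q.2) * hM'

theorem ncard_latticePts_normalForm (n : ℕ) :
    (latticePts (convexHull ℝ {((-1 : ℝ), (1 : ℝ)), ((0 : ℝ), (-1 : ℝ)),
      ((n : ℝ), (0 : ℝ))})).ncard = n + 3 := by
  have hpos : 0 < orient ((-1, 1) : ℤ × ℤ) (0, -1) ((n : ℤ), 0) := by
    simp only [orient]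
    omega
  have hset : latticePts (convexHull ℝ {((-1 : ℝ), (1 : ℝ)), ((0 : ℝ), (-1 : ℝ)),
      ((n : ℝ), (0 : ℝ))}) =
      ((insert (-1, 1) (insert (0, -1) ((Finset.Icc (0 : ℤ) n).image
        fun x => (x, (0 : ℤ)))) : Finset (ℤ × ℤ)) :
          Set (ℤ × ℤ)) := by
    ext ⟨x, y⟩
    have e : ({((-1 : ℝ), (1 : ℝ)), ((0 : ℝ), (-1 : ℝ)), ((n : ℝ), (0 : ℝ))} : Set (ℝ × ℝ)) =
        {toR (-1, 1), toR (0, -1), toR ((n : ℤ), 0)} := by simp [toR]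
    rw [latticePts, Set.mem_ofPred_eq, e,
      mem_convexHull_iff_inTri (by rw [orient_toR]; exact_mod_cast hpos), inTri_toR_iff]
    simp only [InTri, orient, Finset.coe_insert, Finset.coe_image,
      Finset.coe_Icc, Set.mem_insert_iff, Set.mem_image, Set.mem_Icc, Prod.mk.injEq]
    constructor
    · rintro ⟨h₁, h₂, h₃⟩
      have hy : y < 2 := by nlinarith
      have hy' : -2 < y := by nlinarith
      obtain rfl | rfl | rfl : y = -1 ∨ y = 0 ∨ y = 1 := by omega
      · right; left; constructor <;> linarith
      · right; right; exact ⟨x, ⟨by omega, by linarith⟩, rfl, rfl⟩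
      · left; constructor <;> linarith
    · rintro (⟨rfl, rfl⟩ | ⟨rfl, rfl⟩ | ⟨x, ⟨h1, h2⟩, rfl, rfl⟩) <;>
        refine ⟨?_, ?_, ?_⟩ <;> linarith
  rw [hset, Set.ncard_coe_finset, Finset.card_insert_of_notMem (by simp),
    Finset.card_insert_of_notMem (by simp),
    Finset.card_image_of_injective _ (fun x y h => by simpa using h), Int.card_Icc]
  omega

/-- A triangle with a normal form is equivalent to the standard triangle whose size is
determined by the number of lattice points. -/
theorem HasNormalForm.unimodEquiv {A B C : ℤ × ℤ} (h : HasNormalForm A B C) {r : ℕ}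
    (hr : r = (latticePts (convexHull ℝ {toR A, toR B, toR C})).ncard - 3) :
    2 ≤ r ∧ UnimodEquiv (convexHull ℝ {toR A, toR B, toR C})
      (convexHull ℝ {((-1 : ℝ), (1 : ℝ)), ((0 : ℝ), (-1 : ℝ)), ((r : ℝ), (0 : ℝ))}) := by
  obtain ⟨φ, hφ, n, hn, he⟩ := h
  have hbij := hφ.bijective
  obtain ⟨M, v, hM, hMφ⟩ := hφ
  set Γ := convexHull ℝ {toR A, toR B, toR C}
  have hcomm : ∀ p, unimodMap M v (toR p) = toR (φ p) := fun p => by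
    simp [hMφ, unimodMap, toR]
  have himage : convexHull ℝ {((-1 : ℝ), (1 : ℝ)), ((0 : ℝ), (-1 : ℝ)), ((n : ℝ), (0 : ℝ))} =
      unimodMap M v '' Γ := by
    have := congrArg (toR '' ·) he
    simp only [Set.image_insert_eq, Set.image_singleton] at this
    rw [image_unimodMap_convexHull, Set.image_insert_eq, Set.image_insert_eq,
      Set.image_singleton, hcomm, hcomm, hcomm, this]
    simp [toR]
  have hcount : (latticePts Γ).ncard = n + 3 := by
    rw [← ncard_latticePts_normalForm n, himage, ← Set.ncard_image_of_injective _ hbij.1]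
    congr 1
    ext q
    obtain ⟨p, rfl⟩ := hbij.2 q
    rw [hbij.1.mem_set_image, latticePts, latticePts, Set.mem_ofPred_eq, Set.mem_ofPred_eq,
      ← hcomm, (unimodMap_injective hM v).mem_set_image]
  obtain rfl : r = n := by omega
  exact ⟨hn, M, v, by rw [Matrix.det_fin_two, hM]; exact isUnit_one, himage⟩

theorem orient_swap {R : Type*} [CommRing R] (A B C : R × R) :
    orient A C B = -orient A B C := by
  simp only [orient]
  ring

/-- The boundary lattice points of a polygon with exactly three of them are, in counterclockwise
order, its vertices. -/
theorem IsLatticePolygon.exists_triangle {Γ : Set (ℝ × ℝ)} (hpoly : IsLatticePolygon Γ)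
    (hdim : ¬ Collinear ℝ Γ) (hb : (latticePts (frontier Γ)).ncard = 3) :
    ∃ A B C : ℤ × ℤ, 0 < orient A B C ∧ Γ = convexHull ℝ {toR A, toR B, toR C} ∧
      latticePts (frontier Γ) = {A, B, C} := by
  obtain ⟨A, B, C, hAB, -, -, hF⟩ := Set.ncard_eq_three.1 hb
  have hΓ : Γ = convexHull ℝ {toR A, toR B, toR C} := by
    conv_lhs => rw [hpoly.eq_convexHull_frontier, hF]
    simp only [Set.image_insert_eq, Set.image_singleton]
  have hD : orient A B C ≠ 0 := fun h0 => by
    apply hdim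
    have h := collinear_triple_of_orient_eq_zero (toR_injective.ne hAB)
      (by rw [orient_toR, h0, Int.cast_zero] : orient (toR A) (toR B) (toR C) = 0)
    rw [Collinear, ← direction_affineSpan] at h
    rwa [hΓ, Collinear, ← direction_affineSpan, affineSpan_convexHull]
  rcases hD.lt_or_gt with hD | hD
  · refine ⟨A, C, B, by rw [orient_swap]; omega, ?_, ?_⟩
    · rw [hΓ, Set.pair_comm]
    · rw [hF, Set.pair_comm]
  · exact ⟨A, B, C, hD, hΓ, hF⟩

theorem stmt10 (Γ : Set (ℝ × ℝ))
    (hpoly : IsLatticePolygon Γ) (hdim : ¬ Collinear ℝ Γ)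
    (hb : (latticePts (frontier Γ)).ncard = 3)
    (hhyp : IsHyperelliptic Γ)
    (r : ℕ) (hr : r = (latticePts Γ).ncard - 3) :
    2 ≤ r ∧
      UnimodEquiv Γ
        (convexHull ℝ {((-1 : ℝ), (1 : ℝ)), ((0 : ℝ), (-1 : ℝ)), ((r : ℝ), (0 : ℝ))}) := by
  obtain ⟨A, B, C, hD, hΓ, hF⟩ := hpoly.exists_triangle hdim hb
  obtain ⟨hcol, hnt⟩ := hhyp
  have hD' : 0 < orient (toR A) (toR B) (toR C) := by rw [orient_toR]; exact_mod_cast hD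
  have hmem : ∀ p, toR p ∈ Γ ↔ InTri A B C p := fun p => by
    rw [hΓ, mem_convexHull_iff_inTri hD', inTri_toR_iff]
  have hinterior : ∀ p, toR p ∈ interior Γ → InTriStrict A B C p := fun p hp =>
    inTriStrict_of_mem_interior hD (hΓ ▸ hp)
  have hcases : ∀ p, InTri A B C p → p = A ∨ p = B ∨ p = C ∨ toR p ∈ interior Γ := fun p hp => by
    by_cases hi : toR p ∈ interior Γ
    · simp [hi]
    · have : p ∈ latticePts (frontier Γ) := ⟨subset_closure ((hmem p).2 hp), hi⟩
      rw [hF] at this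
      simp only [Set.mem_insert_iff, Set.mem_singleton_iff] at this
      tauto
  have hstrict : ∀ p, InTriStrict A B C p → toR p ∈ interior Γ := fun p hp => by
    rcases hcases p ⟨hp.1.le, hp.2.1.le, hp.2.2.le⟩ with rfl | rfl | rfl | h
    · simpa [orient_self_left] using hp.1
    · simpa [orient_self_left] using hp.2.1
    · simpa [orient_self_left] using hp.2.2
    · exact h
  have hprim : IsPrimitive A B C := ⟨hD, fun p hp => by
    have := hcases p hp
    have := hinterior p
    tauto⟩
  obtain ⟨P, hP, Q, hQ, hPQ⟩ : (latticePts (interior Γ)).Nontrivial := by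
    by_contra hs
    rw [Set.not_nontrivial_iff] at hs
    rcases hs.eq_empty_or_singleton with h | ⟨p, h⟩ <;> simp [interiorHull, h] at hnt
  have hhull : ∀ p, toR p ∈ interior Γ → toR p ∈ interiorHull Γ := fun p hp =>
    subset_convexHull ℝ _ ⟨p, hp, rfl⟩
  have hnf : HasNormalForm A B C := hprim.hasNormalForm hPQ (hinterior P hP) (hinterior Q hQ)
    fun p hp => by
      have := orient_eq_zero_of_collinear hcol (hhull P hP) (hhull Q hQ)
        (hhull p (hstrict p hp))
      rw [orient_toR] at this
      exact_mod_cast this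
  subst hΓ
  exact hnf.unimodEquiv hr
end
end
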